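/- In a commutative A-loop Q, if x satisfies x^{2^n} = 1, then (xy)^{2^n} = y^{2^n} for every y ∈ Q. Consequently, for each n the set H_n(Q) = {x ∈ Q : x^{2^n} = 1} is a normal subloop of Q. -/

import Mathlib

/-- A commutative loop: commutative binary operation with two-sided identity
and a left division making all translations bijective. -/
class CommLoop (Q : Type*) extends Mul Q, One Q where
  mul_comm : ∀ x y : Q, x * y = y * x
  one_mul : ∀ x : Q, 1 * x = x
  mul_one : ∀ x : Q, x * 1 = x
  ldiv : Q → Q → Q
  mul_ldiv : ∀ x y : Q, x * ldiv x y = y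
  ldiv_mul : ∀ x y : Q, ldiv x (x * y) = y

namespace CommLoop

variable {Q : Type*} [CommLoop Q]

/-- The inverse `x⁻¹ = x \ 1`. -/
def inv (x : Q) : Q := ldiv x 1

/-- The inner mapping `L_{x,y} = L_x L_y L_{yx}⁻¹` (permutations acting on the right):
`z L_{x,y} = (yx) \ (y(xz))`. -/
def inn (x y z : Q) : Q := ldiv (y * x) (y * (x * z))

/-- Natural powers: `x^n = 1 L_x^n`. -/
def npow (x : Q) (n : ℕ) : Q := (fun y => x * y)^[n] 1

/-- Integer powers: `x^n = 1 L_x^n`. -/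
def zpow (x : Q) : ℤ → Q
  | Int.ofNat n => npow x n
  | Int.negSucc n => (fun y => ldiv x y)^[n + 1] 1

/-- A commutative A-loop: every inner mapping `L_{x,y}` is an automorphism. -/
class IsALoop (Q : Type*) [CommLoop Q] : Prop where
  inn_mul : ∀ x y u v : Q, inn x y (u * v) = inn x y u * inn x y v

/-- The left translation `L_x` as a permutation of `Q`. -/
def Le (x : Q) : Equiv.Perm Q :=
  ⟨fun y => x * y, fun y => ldiv x y, fun y => ldiv_mul x y, fun y => mul_ldiv x y⟩

/-- The permutation `P_x = L_x L_{x⁻¹}⁻¹`. -/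
def Pe (x : Q) : Equiv.Perm Q := (Le x).trans (Le (inv x)).symm

end CommLoop

namespace CommLoop

section CommLoopLemmas

variable {Q : Type*} [CommLoop Q]

lemma mul_left_cancel {x y z : Q} (h : x * y = x * z) : y = z := by
  rw [← ldiv_mul x y, h, ldiv_mul]

lemma ldiv_eq_of_mul_eq {x y z : Q} (h : x * y = z) : ldiv x z = y := by
  rw [← h, ldiv_mul]

lemma mul_inv (x : Q) : x * inv x = 1 := mul_ldiv x 1

lemma inv_mul (x : Q) : inv x * x = 1 := by rw [mul_comm, mul_inv]

lemma inv_eq_of_mul_eq_one {x y : Q} (h : x * y = 1) : inv x = y := ldiv_eq_of_mul_eq h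

lemma inv_inv (x : Q) : inv (inv x) = x := inv_eq_of_mul_eq_one (inv_mul x)

lemma inv_one : inv (1 : Q) = 1 := inv_eq_of_mul_eq_one (one_mul 1)

lemma mul_inn (x y z : Q) : (y * x) * inn x y z = y * (x * z) := mul_ldiv _ _

lemma inn_one (x y : Q) : inn x y 1 = 1 :=
  ldiv_eq_of_mul_eq (by rw [mul_one, mul_one])

/-- The inner mapping `inn x y` fixes `y`. -/
lemma inn_self_right (x y : Q) : inn x y y = y :=
  ldiv_eq_of_mul_eq (by rw [mul_comm (y * x) y, mul_comm y x])

lemma inn_inv_self (x z : Q) : inn (inv x) x z = x * (inv x * z) :=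
  ldiv_eq_of_mul_eq (by rw [mul_inv, one_mul])

lemma npow_zero (x : Q) : npow x 0 = 1 := rfl

lemma npow_succ (x : Q) (n : ℕ) : npow x (n + 1) = x * npow x n :=
  Function.iterate_succ_apply' _ _ _

lemma npow_one (x : Q) : npow x 1 = x := mul_one x

lemma one_npow (n : ℕ) : npow (1 : Q) n = 1 := by
  induction n with
  | zero => rfl
  | succ n ih => rw [npow_succ, ih, one_mul]

lemma map_npow {R : Type*} [CommLoop R] (f : Q → R) (h_one : f 1 = 1)
    (h_mul : ∀ u v, f (u * v) = f u * f v) (x : Q) (n : ℕ) :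
    f (npow x n) = npow (f x) n := by
  induction n with
  | zero => exact h_one
  | succ n ih => rw [npow_succ, npow_succ, h_mul, ih]

/-- The action of `L_x L_{x⁻¹}⁻¹`, with permutations composed from right to left. -/
def pmap (x z : Q) : Q := x * ldiv (inv x) z

lemma pmap_one_left : pmap (1 : Q) = id := by
  funext z
  rw [pmap, one_mul, inv_one, id]
  exact ldiv_eq_of_mul_eq (one_mul z)

lemma pmap_one_right (x : Q) : pmap x 1 = x * x := by
  rw [pmap, ldiv_eq_of_mul_eq (inv_mul x)]

/-- `L_x L_{x⁻¹}⁻¹` is trivial exactly when `x` squares to `1`. -/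
lemma pmap_eq_pmap_one_iff (x : Q) : pmap x = pmap 1 ↔ x * x = 1 := by
  constructor
  · intro h
    rw [← pmap_one_right, h, pmap_one_right, one_mul]
  · intro h
    rw [pmap_one_left]
    funext z
    rw [pmap, inv_eq_of_mul_eq_one h, mul_ldiv, id]

end CommLoopLemmas

section ALoop

variable {Q : Type*} [CommLoop Q] [IsALoop Q]

lemma inn_mul (x y u v : Q) : inn x y (u * v) = inn x y u * inn x y v :=
  IsALoop.inn_mul x y u v

lemma inn_inv (x y z : Q) : inn x y (inv z) = inv (inn x y z) :=
  (inv_eq_of_mul_eq_one (by rw [← inn_mul, mul_inv, inn_one])).symm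

lemma inn_npow (x y z : Q) (n : ℕ) : inn x y (npow z n) = npow (inn x y z) n :=
  map_npow _ (inn_one x y) (inn_mul x y) z n

lemma npow_add (x : Q) (m n : ℕ) : npow x (m + n) = npow x m * npow x n := by
  induction m with
  | zero => rw [Nat.zero_add, npow_zero, one_mul]
  | succ m ih =>
    rw [Nat.add_right_comm, npow_succ, ih, npow_succ, ← mul_inn (npow x m) x (npow x n),
      inn_npow, inn_self_right]

lemma npow_two_pow_succ (x : Q) (n : ℕ) :
    npow x (2 ^ (n + 1)) = npow x (2 ^ n) * npow x (2 ^ n) := by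
  rw [pow_succ, Nat.mul_two, npow_add]

/-- `L_x` commutes with `L_{x⁻¹}`. -/
lemma mul_inv_mul_left (x z : Q) : x * (inv x * z) = inv x * (x * z) := by
  have h := inn_mul (inv x) x x z
  rw [inn_self_right, inn_inv_self, inn_inv_self] at h
  exact (mul_left_cancel h).symm

/-- The automorphic inverse property. -/
lemma inv_mul_distrib (x y : Q) : inv (x * y) = inv x * inv y := by
  have h_inn : inn y x y * inv (x * y) = inv x := by
    have h : inn y x (ldiv y (inv x)) = inv (x * y) := by
      rw [inn, mul_ldiv, mul_inv]
      rfl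
    rw [← h, ← inn_mul, mul_ldiv, inn_inv, inn_self_right]
  have h_comp (z : Q) :
      inn (inv (x * y)) (x * y) (inn y x z) = inv (x * y) * (x * (y * z)) := by
    rw [inn_inv_self, mul_inv_mul_left, mul_inn]
  have h_left : inn (inv (x * y)) (x * y) (inn y x y) = inn (inv x) x y := by
    rw [inn_inv_self, mul_comm (inv (x * y)), h_inn, inn_inv_self, mul_inv_mul_left, mul_comm]
  have h := h_comp (inv y)
  rw [inn_inv, inn_inv, h_left, ← inn_inv, inn_inv_self, mul_inv, mul_one,
    mul_comm (inv (x * y))] at h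
  exact (mul_left_cancel h).symm

lemma inn_inv_inv (x y z : Q) : inn (inv x) (inv y) z = inn x y z := by
  apply ldiv_eq_of_mul_eq
  have h := congrArg inv (mul_inn x y (inv z))
  simpa only [inn_inv, inv_mul_distrib, inv_inv] using h

lemma pmap_mul (x y z : Q) : pmap (x * y) z = x * pmap y (ldiv (inv x) z) := by
  have h : ldiv (inv (x * y)) z = inn y x (ldiv (inv y) (ldiv (inv x) z)) := by
    apply ldiv_eq_of_mul_eq
    rw [inv_mul_distrib, ← inn_inv_inv, mul_inn, mul_ldiv, mul_ldiv]
  rw [pmap, h, mul_inn, pmap]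

lemma pmap_mul_right_iff (x y z : Q) : pmap (x * y) = pmap (x * z) ↔ pmap y = pmap z := by
  constructor
  · intro h
    funext w
    have hw := congrFun h (inv x * w)
    rw [pmap_mul, pmap_mul, ldiv_mul] at hw
    exact mul_left_cancel hw
  · intro h
    funext w
    rw [pmap_mul, pmap_mul, h]

lemma pmap_mul_congr {x x' y y' : Q} (hx : pmap x = pmap x') (hy : pmap y = pmap y') :
    pmap (x * y) = pmap (x' * y') := by
  rw [(pmap_mul_right_iff x y y').2 hy, mul_comm x, mul_comm x', pmap_mul_right_iff, hx]

lemma pmap_ldiv_congr {x x' y y' : Q} (hx : pmap x = pmap x') (hy : pmap y = pmap y') :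
    pmap (ldiv x y) = pmap (ldiv x' y') := by
  rw [← pmap_mul_right_iff x, mul_ldiv, hy, pmap_mul_congr hx rfl, mul_ldiv]

variable (Q) in
/-- The congruence identifying elements with the same permutation `L_x L_{x⁻¹}⁻¹`. -/
def pmapSetoid : Setoid Q := Setoid.ker pmap

instance : CommLoop (Quotient (pmapSetoid Q)) where
  mul := Quotient.map₂ (· * ·) fun _ _ hx _ _ hy => pmap_mul_congr hx hy
  one := Quotient.mk _ 1
  ldiv := Quotient.map₂ ldiv fun _ _ hx _ _ hy => pmap_ldiv_congr hx hy
  mul_comm := by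
    rintro ⟨x⟩ ⟨y⟩
    exact congrArg (Quotient.mk _) (mul_comm x y)
  one_mul := by
    rintro ⟨x⟩
    exact congrArg (Quotient.mk _) (one_mul x)
  mul_one := by
    rintro ⟨x⟩
    exact congrArg (Quotient.mk _) (mul_one x)
  mul_ldiv := by
    rintro ⟨x⟩ ⟨y⟩
    exact congrArg (Quotient.mk _) (mul_ldiv x y)
  ldiv_mul := by
    rintro ⟨x⟩ ⟨y⟩
    exact congrArg (Quotient.mk _) (ldiv_mul x y)

instance : IsALoop (Quotient (pmapSetoid Q)) where
  inn_mul := by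
    rintro ⟨x⟩ ⟨y⟩ ⟨u⟩ ⟨v⟩
    exact congrArg (Quotient.mk _) (inn_mul x y u v)

lemma mk_npow (x : Q) (n : ℕ) :
    Quotient.mk (pmapSetoid Q) (npow x n) = npow (Quotient.mk (pmapSetoid Q) x) n :=
  map_npow _ rfl (fun _ _ => rfl) x n

end ALoop

theorem npow_two_pow_mul {Q : Type*} [CommLoop Q] [IsALoop Q] (n : ℕ) {x : Q}
    (hx : npow x (2 ^ n) = 1) (y : Q) : npow (x * y) (2 ^ n) = npow y (2 ^ n) := by
  induction n generalizing Q with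
  | zero =>
    rw [pow_zero, npow_one] at hx
    rw [hx, one_mul]
  | succ n ih =>
    rw [npow_two_pow_succ, ← pmap_eq_pmap_one_iff] at hx
    have h_one : npow (Quotient.mk (pmapSetoid Q) x) (2 ^ n) = 1 := by
      rw [← mk_npow]
      exact Quotient.sound hx
    have h := ih h_one (Quotient.mk _ y)
    change npow (Quotient.mk (pmapSetoid Q) (x * y)) (2 ^ n) = _ at h
    rw [← mk_npow, ← mk_npow] at h
    have h_pmap : pmap (npow (x * y) (2 ^ n)) = pmap (npow y (2 ^ n)) := Quotient.exact h
    rw [npow_two_pow_succ, npow_two_pow_succ, ← pmap_one_right, h_pmap, pmap_one_right]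

end CommLoop

open CommLoop in
/-- If `x^{2^n} = 1` then `(xy)^{2^n} = y^{2^n}` for all `y`; consequently
`H_n(Q) = {x : x^{2^n} = 1}` is a normal subloop. -/
theorem stmt18 {Q : Type*} [CommLoop Q] [IsALoop Q] (n : ℕ) :
    (∀ x : Q, npow x (2 ^ n) = 1 → ∀ y : Q, npow (x * y) (2 ^ n) = npow y (2 ^ n)) ∧
    (1 : Q) ∈ {x : Q | npow x (2 ^ n) = 1} ∧
    (∀ a ∈ {x : Q | npow x (2 ^ n) = 1}, ∀ b ∈ {x : Q | npow x (2 ^ n) = 1},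
      a * b ∈ {x : Q | npow x (2 ^ n) = 1}) ∧
    (∀ a ∈ {x : Q | npow x (2 ^ n) = 1}, ∀ b ∈ {x : Q | npow x (2 ^ n) = 1},
      ldiv a b ∈ {x : Q | npow x (2 ^ n) = 1}) ∧
    (∀ u v : Q, ∀ z ∈ {x : Q | npow x (2 ^ n) = 1},
      inn u v z ∈ {x : Q | npow x (2 ^ n) = 1}) := by
  refine ⟨fun x hx y => npow_two_pow_mul n hx y, one_npow _, fun a ha b hb => ?_,
    fun a ha b hb => ?_, fun u v z hz => ?_⟩
  · exact (npow_two_pow_mul n ha b).trans hb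
  · have h := npow_two_pow_mul n ha (ldiv a b)
    rw [mul_ldiv] at h
    exact h.symm.trans hb
  · change npow (inn u v z) (2 ^ n) = 1
    rw [← inn_npow, hz, inn_one]
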